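/- Let Γ be an infinite group generated by a finite generating family S, G = Cay(Γ, S), and p ∈ (0, 1). Then the number of infinite clusters of the open subgraph ω is P_p-almost surely equal to a constant N_p, and N_p ∈ {0, 1, ∞}. -/

import Mathlib

open MeasureTheory Set

noncomputable section

variable {Γ : Type} [Group Γ] {d : ℕ}

/-- The edge `(g, i)` of the Cayley graph `Cay(Γ, S)` joins `g` and `g * S i`. -/
def Joins (S : Fin d → Γ) (e : Γ × Fin d) (u v : Γ) : Prop :=
  (u = e.1 ∧ v = e.1 * S e.2) ∨ (v = e.1 ∧ u = e.1 * S e.2)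

/-- `u` and `v` are connected by a path of `ω`-open edges. -/
def OpenConn (S : Fin d → Γ) (ω : Γ × Fin d → Bool) (u v : Γ) : Prop :=
  Relation.ReflTransGen (fun a b => ∃ e, ω e = true ∧ Joins S e a b) u v

/-- The cluster of `v` in `ω`. -/
def Cluster (S : Fin d → Γ) (ω : Γ × Fin d → Bool) (v : Γ) : Set Γ :=
  {u | OpenConn S ω v u}

/-- `P` is Bernoulli(`p`) bond percolation on `Cay(Γ, S)`. -/
def IsBernoulli (S : Fin d → Γ) (p : ℝ) (P : Measure (Γ × Fin d → Bool)) : Prop :=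
  IsProbabilityMeasure P ∧
    ∀ (s : Finset (Γ × Fin d)) (f : Γ × Fin d → Bool),
      P {ω | ∀ e ∈ s, ω e = f e} = ∏ e ∈ s, ENNReal.ofReal (if f e then p else 1 - p)

/-- The set of infinite clusters of the configuration `ω`. -/
def InfClusters (S : Fin d → Γ) (ω : Γ × Fin d → Bool) : Set (Set Γ) :=
  {C | (∃ v, C = Cluster S ω v) ∧ C.Infinite}

open ProbabilityTheory Function

section ProductMeasure

variable {ι X : Type*} [MeasurableSpace X] (μ : Measure X) [IsProbabilityMeasure μ]

theorem indep_cylinderEvents_infinitePi {s t : Set ι} (h : Disjoint s t) :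
    Indep (cylinderEvents (X := fun _ : ι ↦ X) s) (cylinderEvents t)
      (Measure.infinitePi fun _ : ι ↦ μ) :=
  indep_iSup_of_disjoint (fun i ↦ (measurable_pi_apply i).comap_le)
    (iIndepFun_infinitePi (P := fun _ : ι ↦ μ) (X := fun _ x ↦ x) fun _ ↦ measurable_id) h

theorem measurePreserving_reindex_infinitePi (σ : ι ≃ ι) :
    MeasurePreserving (fun ω : ι → X ↦ ω ∘ σ) (Measure.infinitePi fun _ : ι ↦ μ)
      (Measure.infinitePi fun _ : ι ↦ μ) := by
  have hm : Measurable fun ω : ι → X ↦ ω ∘ σ :=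
    measurable_pi_iff.2 fun i ↦ measurable_pi_apply (σ i)
  refine ⟨hm, Measure.eq_infinitePi _ fun s t ht ↦ ?_⟩
  rw [Measure.map_apply hm (.pi s.countable_toSet fun i _ ↦ ht i)]
  have : (fun ω : ι → X ↦ ω ∘ σ) ⁻¹' (s : Set ι).pi t
      = ((s.map σ.toEmbedding : Finset ι) : Set ι).pi fun i ↦ t (σ.symm i) := by
    ext ω
    simp only [mem_preimage, Set.mem_pi, Finset.coe_map, Equiv.coe_toEmbedding, comp_apply,
      forall_mem_image, Equiv.symm_apply_apply]
  rw [this, Measure.infinitePi_pi _ (fun i _ ↦ ht _)]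
  simp

/-- Events invariant under reindexings that move every finite set of coordinates off itself
are trivial for a product measure. -/
theorem measureReal_eq_zero_or_one_of_invariant {A : Set (ι → X)} (hA : MeasurableSet A)
    (h : ∀ s : Finset ι, ∃ σ : ι ≃ ι, Disjoint (s : Set ι) (σ '' s) ∧
      (fun ω : ι → X ↦ ω ∘ σ) ⁻¹' A = A) :
    (Measure.infinitePi fun _ : ι ↦ μ).real A = 0 ∨
      (Measure.infinitePi fun _ : ι ↦ μ).real A = 1 := by
  set P := Measure.infinitePi fun _ : ι ↦ μ with hP
  have key : ∀ ε : ℝ, 0 < ε → |P.real A - P.real A * P.real A| ≤ 4 * ε := by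
    intro ε hε
    obtain ⟨C, hC, hCA⟩ := exists_measure_symmDiff_lt_of_generateFrom_isSetRing (μ := P)
      (isSetRing_measurableCylinders (α := fun _ : ι ↦ X))
      ⟨{univ}, countable_singleton _,
        singleton_subset_iff.2 (univ_mem_measurableCylinders fun _ : ι ↦ X), by simp⟩
      generateFrom_measurableCylinders.symm hA (ENNReal.ofReal_pos.2 hε)
    have hCm : MeasurableSet C := .of_mem_measurableCylinders hC
    obtain ⟨s, B, hB, rfl⟩ := (mem_measurableCylinders C).1 hC
    obtain ⟨σ, hσ, hσA⟩ := h s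
    set C := cylinder (α := fun _ : ι ↦ X) s B
    set T : (ι → X) → (ι → X) := fun ω ↦ ω ∘ σ
    have hT : MeasurePreserving T P P := measurePreserving_reindex_infinitePi μ σ
    have hC1 : MeasurableSet[cylinderEvents (s : Set ι)] C :=
      measurable_restrict_cylinderEvents (X := fun _ : ι ↦ X) (s : Set ι) hB
    have hC2 : MeasurableSet[cylinderEvents (σ '' s)] (T ⁻¹' C) := by
      refine Measurable.of_comap_le ?_ hC1
      exact (measurable_cylinderEvents_iff.2 fun i hi ↦
        measurable_cylinderEvent_apply (mem_image_of_mem σ hi)).comap_le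
    have hind : P.real (C ∩ T ⁻¹' C) = P.real C * P.real C := by
      have := (Indep_iff _ _ _).1 (indep_cylinderEvents_infinitePi μ hσ) _ _ hC1 hC2
      rw [← hP, hT.measure_preimage hCm.nullMeasurableSet] at this
      simp [Measure.real, this]
    have h1 : P.real (symmDiff C A) ≤ ε :=
      ENNReal.toReal_le_of_le_ofReal hε.le hCA.le
    have h2 : P.real (symmDiff (T ⁻¹' C) A) ≤ ε := by
      rw [← hσA, ← preimage_symmDiff, measureReal_def,
        hT.measure_preimage (hCm.symmDiff hA).nullMeasurableSet]
      exact h1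
    have h3 : P.real (symmDiff (C ∩ T ⁻¹' C) A) ≤ ε + ε := by
      refine (measureReal_mono ?_).trans ((measureReal_union_le _ _).trans (add_le_add h1 h2))
      intro x
      simp only [mem_symmDiff, mem_inter_iff, mem_union]
      tauto
    have h4 := (abs_measureReal_sub_le_measureReal_symmDiff (μ := P)
      hCm.nullMeasurableSet hA.nullMeasurableSet).trans h1
    have h5 := (abs_measureReal_sub_le_measureReal_symmDiff (μ := P)
      (hCm.inter (hT.measurable hCm)).nullMeasurableSet hA.nullMeasurableSet).trans h3
    rw [hind] at h5
    have a0 : 0 ≤ P.real A := measureReal_nonneg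
    have a1 : P.real A ≤ 1 := measureReal_le_one
    have c0 : 0 ≤ P.real C := measureReal_nonneg
    have c1 : P.real C ≤ 1 := measureReal_le_one
    rw [abs_le] at h4 h5 ⊢
    constructor <;> nlinarith
  have h0 : |P.real A - P.real A * P.real A| ≤ 0 :=
    le_of_forall_pos_le_add fun ε hε ↦ by linarith [key (ε / 4) (by positivity)]
  have h1 : P.real A * (1 - P.real A) = 0 := by
    linarith [abs_nonpos_iff.1 h0]
  rcases mul_eq_zero.1 h1 with h | h
  · exact .inl h
  · exact .inr (by linarith)

theorem quasiMeasurePreserving_update_infinitePi [DecidableEq ι] [MeasurableSingletonClass X]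
    (i : ι) (x : X) (hx : μ {x} ≠ 0) :
    Measure.QuasiMeasurePreserving (fun ω : ι → X ↦ update ω i x)
      (Measure.infinitePi fun _ : ι ↦ μ) (Measure.infinitePi fun _ : ι ↦ μ) := by
  have hm' : Measurable[cylinderEvents {i}ᶜ] fun ω : ι → X ↦ update ω i x := by
    refine @measurable_pi_lambda _ _ _ (_) _ _ fun j ↦ ?_
    rcases eq_or_ne j i with rfl | hj
    · simp
    · simpa [hj] using measurable_cylinderEvent_apply (X := fun _ : ι ↦ X) (Δ := {i}ᶜ) hj
  have hm : Measurable fun ω : ι → X ↦ update ω i x := hm'.mono cylinderEvents_le_pi le_rfl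
  refine ⟨hm, .mk fun A hA hPA ↦ ?_⟩
  rw [Measure.map_apply hm hA]
  have hE : MeasurableSet[cylinderEvents {i}] {ω : ι → X | ω i = x} :=
    measurable_cylinderEvent_apply (X := fun _ : ι ↦ X) (mem_singleton i)
      (measurableSet_singleton x)
  have hind := (Indep_iff _ _ _).1
    (indep_cylinderEvents_infinitePi μ (disjoint_compl_left (a := ({i} : Set ι)))) _ _
    (hm' hA) hE
  have hsub : (fun ω : ι → X ↦ update ω i x) ⁻¹' A ∩ {ω | ω i = x} ⊆ A := by
    rintro ω ⟨h1, rfl⟩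
    simpa using h1
  rw [measure_mono_null hsub hPA] at hind
  have hEP : Measure.infinitePi (fun _ : ι ↦ μ) {ω : ι → X | ω i = x} = μ {x} :=
    (measurePreserving_eval_infinitePi (fun _ : ι ↦ μ) i).measure_preimage
      (measurableSet_singleton x).nullMeasurableSet
  rw [hEP] at hind
  exact (mul_eq_zero.1 hind.symm).resolve_right hx

end ProductMeasure

/-- The law of a single edge. -/
def edgeLaw (p : ℝ) : Measure Bool :=
  ENNReal.ofReal p • Measure.dirac true + ENNReal.ofReal (1 - p) • Measure.dirac false

theorem edgeLaw_singleton (p : ℝ) (b : Bool) :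
    edgeLaw p {b} = ENNReal.ofReal (if b then p else 1 - p) := by
  cases b <;> simp [edgeLaw]

theorem isProbabilityMeasure_edgeLaw {p : ℝ} (hp : p ∈ Icc (0 : ℝ) 1) :
    IsProbabilityMeasure (edgeLaw p) := by
  constructor
  simp only [edgeLaw, Measure.coe_add, Measure.coe_smul, Pi.add_apply, Pi.smul_apply,
    measure_univ, smul_eq_mul, mul_one]
  rw [← ENNReal.ofReal_add hp.1 (by linarith [hp.2])]
  simp

theorem IsBernoulli.eq_infinitePi {V : Type} {S : Fin d → V} {p : ℝ}
    [IsProbabilityMeasure (edgeLaw p)] {P : Measure (V × Fin d → Bool)} (hP : IsBernoulli S p P) :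
    P = Measure.infinitePi fun _ ↦ edgeLaw p := by
  have := hP.1
  refine IsProjectiveLimit.unique (P := fun s : Finset (V × Fin d) ↦
    Measure.pi fun _ : s ↦ edgeLaw p) (fun s ↦ ?_) (Measure.isProjectiveLimit_infinitePi _)
  refine Measure.ext_of_singleton fun f ↦ ?_
  classical
  have hpre : s.restrict (π := fun _ ↦ Bool) ⁻¹' {f} =
      {ω : V × Fin d → Bool | ∀ e ∈ s, ω e = if h : e ∈ s then f ⟨e, h⟩ else true} := by
    ext ω
    simp only [mem_preimage, mem_singleton_iff, funext_iff, Finset.restrict, Subtype.forall,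
      mem_ofPred_eq]
    refine forall₂_congr fun e he ↦ ?_
    simp [he]
  rw [Measure.map_apply (by fun_prop) (measurableSet_singleton f), hpre, hP.2,
    Measure.pi_singleton, ← Finset.prod_coe_sort]
  refine Finset.prod_congr rfl fun e _ ↦ ?_
  simp [edgeLaw_singleton]

section Deterministic

variable {S : Fin d → Γ} {ω ω' : Γ × Fin d → Bool} {u v w : Γ}

theorem OpenConn.symm (h : OpenConn S ω u v) : OpenConn S ω v u :=
  have : Std.Symm fun a b ↦ ∃ e, ω e = true ∧ Joins S e a b :=
    ⟨fun _ _ ⟨e, he, hj⟩ ↦ ⟨e, he, hj.symm⟩⟩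
  symm_of (Relation.ReflTransGen _) h

theorem OpenConn.trans (h : OpenConn S ω u v) (h' : OpenConn S ω v w) : OpenConn S ω u w :=
  Relation.ReflTransGen.trans h h'

theorem OpenConn.mono (hω : ∀ e, ω e = true → ω' e = true) (h : OpenConn S ω u v) :
    OpenConn S ω' u v :=
  Relation.ReflTransGen.mono (fun _ _ ⟨e, he, hj⟩ ↦ ⟨e, hω e he, hj⟩) _ _ h

theorem cluster_eq_iff : Cluster S ω u = Cluster S ω v ↔ OpenConn S ω u v := by
  refine ⟨fun h ↦ ?_, fun h ↦ ?_⟩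
  · change v ∈ Cluster S ω u
    rw [h]
    exact Relation.ReflTransGen.refl
  · ext x
    exact ⟨h.symm.trans, h.trans⟩

theorem mem_infClusters_iff : Cluster S ω v ∈ InfClusters S ω ↔ (Cluster S ω v).Infinite :=
  ⟨And.right, fun h ↦ ⟨⟨v, rfl⟩, h⟩⟩

theorem joins_shift (g : Γ) (e : Γ × Fin d) :
    Joins S (g * e.1, e.2) (g * u) (g * v) ↔ Joins S e u v := by
  simp [Joins, mul_assoc]

/-- The action of left translation by `g` on the edges of the Cayley graph. -/
def edgeShift (d : ℕ) (g : Γ) : Γ × Fin d ≃ Γ × Fin d :=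
  (Equiv.mulLeft g).prodCongr (Equiv.refl _)

theorem openConn_edgeShift (g : Γ) :
    OpenConn S (ω ∘ edgeShift d g) u v ↔ OpenConn S ω (g * u) (g * v) := by
  constructor
  · intro h
    refine Relation.ReflTransGen.lift (g * ·) ?_ _ _ h
    rintro a b ⟨e, he, hj⟩
    exact ⟨_, he, (joins_shift g e).2 hj⟩
  · intro h
    have : OpenConn S (ω ∘ edgeShift d g) (g⁻¹ * (g * u)) (g⁻¹ * (g * v)) := by
      refine Relation.ReflTransGen.lift (g⁻¹ * ·) ?_ _ _ h
      rintro a b ⟨e, he, hj⟩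
      exact ⟨(g⁻¹ * e.1, e.2), by simpa [edgeShift] using he, (joins_shift g⁻¹ e).2 hj⟩
    simpa using this

theorem cluster_edgeShift (g : Γ) :
    (g * ·) '' Cluster S (ω ∘ edgeShift d g) v = Cluster S ω (g * v) := by
  ext x
  constructor
  · rintro ⟨u, hu, rfl⟩
    exact (openConn_edgeShift g).1 hu
  · intro hx
    refine ⟨g⁻¹ * x, (openConn_edgeShift g).2 ?_, by simp⟩
    rwa [mul_inv_cancel_left]

theorem encard_infClusters_edgeShift (g : Γ) :
    (InfClusters S (ω ∘ edgeShift d g)).encard = (InfClusters S ω).encard := by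
  have hinj : Injective (g * · : Γ → Γ) := mul_right_injective g
  rw [← hinj.image_injective.encard_image]
  congr 1
  ext C
  constructor
  · rintro ⟨_, ⟨⟨v, rfl⟩, hv⟩, rfl⟩
    exact ⟨⟨g * v, cluster_edgeShift g⟩, hv.image hinj.injOn⟩
  · rintro ⟨⟨v, rfl⟩, hv⟩
    have h : (g * ·) '' Cluster S (ω ∘ edgeShift d g) (g⁻¹ * v) = Cluster S ω v := by
      simpa using cluster_edgeShift (S := S) (ω := ω) (v := g⁻¹ * v) g
    rw [← h] at hv ⊢
    exact ⟨_, mem_infClusters_iff.2 (hv.of_image _), rfl⟩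

variable [DecidableEq (Γ × Fin d)]

theorem OpenConn.update_true (e : Γ × Fin d) (h : OpenConn S ω u v) :
    OpenConn S (update ω e true) u v := by
  refine h.mono fun e' he' ↦ ?_
  by_cases hee : e' = e
  · simp [hee]
  · simpa [hee] using he'

theorem openConn_update_of_joins {e : Γ × Fin d} (h : Joins S e u v) :
    OpenConn S (update ω e true) u v :=
  .single ⟨e, by simp, h⟩

theorem exists_openConn_of_openConn_update {e : Γ × Fin d} {x : Γ}
    (h : OpenConn S (update ω e true) v x) :
    ∃ w ∈ ({v, e.1, e.1 * S e.2} : Set Γ),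
      OpenConn S (update ω e true) v w ∧ OpenConn S ω w x := by
  induction h with
  | refl => exact ⟨v, by simp, .refl, .refl⟩
  | @tail b c hb hbc ih =>
    obtain ⟨e', he', hj⟩ := hbc
    by_cases hee : e' = e
    · subst hee
      refine ⟨c, ?_, hb.tail ⟨e', he', hj⟩, .refl⟩
      rcases hj with ⟨-, rfl⟩ | ⟨rfl, -⟩ <;> simp
    · obtain ⟨w, hw, h1, h2⟩ := ih
      exact ⟨w, hw, h1, h2.tail ⟨e', by simpa [hee] using he', hj⟩⟩

theorem exists_infinite_cluster_of_update {e : Γ × Fin d}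
    (h : (Cluster S (update ω e true) v).Infinite) :
    ∃ w, OpenConn S (update ω e true) v w ∧ (Cluster S ω w).Infinite := by
  by_contra! hfin
  refine h (Set.Finite.subset (s := ⋃ w ∈ {w ∈ ({v, e.1, e.1 * S e.2} : Set Γ) |
    OpenConn S (update ω e true) v w}, Cluster S ω w) ?_ ?_)
  · refine Set.Finite.biUnion (Set.Finite.subset (by simp) (sep_subset _ _)) fun w hw ↦ ?_
    exact hfin w hw.2
  · intro x hx
    obtain ⟨w, hw, h1, h2⟩ := exists_openConn_of_openConn_update hx
    exact mem_biUnion (show w ∈ {w ∈ _ | _} from ⟨hw, h1⟩) h2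

/-- If opening an edge leaves the finite number of infinite clusters unchanged, it joins no two
distinct infinite clusters. -/
theorem openConn_of_openConn_update {e : Γ × Fin d} (hfin : (InfClusters S ω).Finite)
    (hcard : (InfClusters S (update ω e true)).encard = (InfClusters S ω).encard)
    (hu : (Cluster S ω u).Infinite) (hv : (Cluster S ω v).Infinite)
    (h : OpenConn S (update ω e true) u v) : OpenConn S ω u v := by
  let φ : Set Γ → Set Γ := fun C ↦ {x | ∃ y ∈ C, OpenConn S (update ω e true) y x}
  have hφ (w : Γ) : φ (Cluster S ω w) = Cluster S (update ω e true) w := by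
    ext x
    exact ⟨fun ⟨y, hy, hyx⟩ ↦ (OpenConn.update_true e hy).trans hyx, fun hx ↦ ⟨w, .refl, hx⟩⟩
  have hsub : InfClusters S (update ω e true) ⊆ φ '' InfClusters S ω := by
    rintro _ ⟨⟨w, rfl⟩, hw⟩
    obtain ⟨w', hw', hinf⟩ := exists_infinite_cluster_of_update hw
    exact ⟨_, mem_infClusters_iff.2 hinf, (hφ w').trans (cluster_eq_iff.2 hw'.symm)⟩
  have hinj : InjOn φ (InfClusters S ω) :=
    hfin.injOn_of_encard_image_eq
      (le_antisymm (encard_image_le _ _) (hcard ▸ encard_le_encard hsub))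
  refine cluster_eq_iff.1 (hinj (mem_infClusters_iff.2 hu) (mem_infClusters_iff.2 hv) ?_)
  rw [hφ, hφ]
  exact cluster_eq_iff.2 h

end Deterministic

section Measurability

variable (S : Fin d → Γ) [Countable Γ]

theorem measurableSet_openConn (u v : Γ) : MeasurableSet {ω | OpenConn S ω u v} := by
  have hstep (a b : Γ) :
      MeasurableSet {ω : Γ × Fin d → Bool | ∃ e, ω e = true ∧ Joins S e a b} := by
    have h (e : Γ × Fin d) : MeasurableSet {ω : Γ × Fin d → Bool | ω e = true} :=
      measurableSet_eq_fun (measurable_pi_apply e) measurable_const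
    simp only [ofPred_exists, ofPred_and]
    exact .iUnion fun e ↦ (h e).inter (.const _)
  have hchain (l : List Γ) : ∀ a, MeasurableSet {ω : Γ × Fin d → Bool |
      List.IsChain (fun a b => ∃ e, ω e = true ∧ Joins S e a b) (a :: l)} := by
    induction l with
    | nil => intro a; simp
    | cons b l ih =>
      intro a
      simp only [List.isChain_cons_cons, ofPred_and]
      exact (hstep a b).inter (ih b)
  have : {ω | OpenConn S ω u v} = ⋃ l : List Γ, {ω : Γ × Fin d → Bool |
      List.IsChain (fun a b => ∃ e, ω e = true ∧ Joins S e a b) (u :: l)} ∩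
        {_ω | (u :: l).getLast (List.cons_ne_nil _ _) = v} := by
    ext ω
    simp only [mem_iUnion, mem_inter_iff, mem_ofPred_eq]
    constructor
    · intro h
      exact List.exists_isChain_cons_of_relationReflTransGen h
    · rintro ⟨l, hl, rfl⟩
      exact List.relationReflTransGen_of_exists_isChain_cons l hl rfl
  rw [this]
  exact .iUnion fun l ↦ (hchain l u).inter (.const _)

theorem measurableSet_infinite_cluster (v : Γ) : MeasurableSet {ω | (Cluster S ω v).Infinite} := by
  have h : Measurable fun ω ↦ Cluster S ω v :=
    measurable_set_iff.2 fun u ↦ measurableSet_setOfPred.1 (measurableSet_openConn S v u)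
  simp only [← encard_eq_top_iff]
  exact (measurable_encard.comp h) (measurableSet_singleton ⊤)

theorem measurable_encard_infClusters :
    Measurable fun ω ↦ (InfClusters S ω).encard := by
  obtain ⟨f, hf⟩ := exists_injective_nat Γ
  let R (ω : Γ × Fin d → Bool) : Set Γ :=
    {v | (Cluster S ω v).Infinite ∧ ∀ u, OpenConn S ω v u → f v ≤ f u}
  have hR : Measurable R := by
    refine measurable_set_iff.2 fun v ↦ measurableSet_setOfPred.1 ?_
    have h (u : Γ) : MeasurableSet {ω | OpenConn S ω v u → f v ≤ f u} :=
      (measurableSet_openConn S v u).imp (.const _)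
    have h' : MeasurableSet {ω | ∀ u, OpenConn S ω v u → f v ≤ f u} := by
      simpa only [ofPred_forall] using MeasurableSet.iInter h
    exact (measurableSet_infinite_cluster S v).inter h'
  have hcard (ω) : (InfClusters S ω).encard = (R ω).encard := by
    have hinj : InjOn (Cluster S ω) (R ω) := by
      intro u hu v hv huv
      have h := cluster_eq_iff.1 huv
      exact hf (le_antisymm (hu.2 v h) (hv.2 u h.symm))
    rw [← hinj.encard_image]
    congr 1
    ext C
    constructor
    · rintro ⟨⟨v, rfl⟩, hv⟩
      obtain ⟨u, hu, hmin⟩ := exists_minimalFor_of_wellFoundedLT (· ∈ Cluster S ω v) f ⟨v, .refl⟩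
      have huv : Cluster S ω u = Cluster S ω v := cluster_eq_iff.2 (OpenConn.symm hu)
      refine ⟨u, ⟨huv ▸ hv, fun w hw ↦ ?_⟩, huv⟩
      exact (le_total (f u) (f w)).elim id fun h ↦ hmin (OpenConn.trans hu hw) h
    · rintro ⟨v, hv, rfl⟩
      exact mem_infClusters_iff.2 hv.1
  simp only [hcard]
  exact measurable_encard.comp hR

end Measurability

theorem exists_disjoint_edgeShift [Infinite Γ] (s : Finset (Γ × Fin d)) :
    ∃ g : Γ, Disjoint (s : Set (Γ × Fin d)) (edgeShift d g '' s) := by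
  classical
  obtain ⟨g, hg⟩ := Infinite.exists_notMem_finset
    ((s ×ˢ s).image fun x ↦ x.1.1 * x.2.1⁻¹)
  refine ⟨g, Set.disjoint_left.2 ?_⟩
  rintro _ he ⟨e, he', rfl⟩
  refine hg (Finset.mem_image.2 ⟨(edgeShift d g e, e), Finset.mem_product.2 ⟨he, he'⟩, ?_⟩)
  simp [edgeShift]

/-- The number of infinite clusters is almost surely constant. -/
theorem exists_ae_encard_infClusters_eq [Infinite Γ] [Countable Γ] (S : Fin d → Γ)
    (μ : Measure Bool) [IsProbabilityMeasure μ] :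
    ∃ N : ℕ∞, ∀ᵐ ω ∂Measure.infinitePi fun _ ↦ μ, (InfClusters S ω).encard = N := by
  set P := Measure.infinitePi fun _ : Γ × Fin d ↦ μ
  have hm (N : ℕ∞) : MeasurableSet {ω | (InfClusters S ω).encard = N} :=
    measurable_encard_infClusters S (measurableSet_singleton N)
  have h01 (N : ℕ∞) : P.real {ω | (InfClusters S ω).encard = N} = 0 ∨
      P.real {ω | (InfClusters S ω).encard = N} = 1 := by
    refine measureReal_eq_zero_or_one_of_invariant μ (hm N) fun s ↦ ?_
    obtain ⟨g, hg⟩ := exists_disjoint_edgeShift s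
    refine ⟨edgeShift d g, hg, ?_⟩
    ext ω
    simp [encard_infClusters_edgeShift]
  by_contra hN
  rw [not_exists] at hN
  have h0 (N : ℕ∞) : ∀ᵐ ω ∂P, (InfClusters S ω).encard ≠ N := by
    rcases h01 N with h | h
    · rw [measureReal_eq_zero_iff] at h
      simpa [ae_iff] using h
    · exact absurd ((mem_ae_iff_prob_eq_one (hm N)).2 ((ENNReal.toReal_eq_one_iff _).1 h)) (hN N)
  have : ∀ᵐ ω ∂P, False := by
    filter_upwards [ae_all_iff.2 h0] with ω hω
    exact hω _ rfl
  simp [ae_iff] at this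

/-- If the number of infinite clusters is almost surely a finite constant, then almost surely
all infinite clusters coincide. -/
theorem ae_openConn_of_ae_encard_eq [Countable Γ] {S : Fin d → Γ}
    (hgen : Subgroup.closure (Set.range S) = ⊤) {μ : Measure Bool} [IsProbabilityMeasure μ]
    (hμ : μ {true} ≠ 0) {N : ℕ∞} (hN : N ≠ ⊤)
    (h : ∀ᵐ ω ∂Measure.infinitePi fun _ ↦ μ, (InfClusters S ω).encard = N) (u v : Γ) :
    ∀ᵐ ω ∂Measure.infinitePi fun _ ↦ μ,
      (Cluster S ω u).Infinite → (Cluster S ω v).Infinite → OpenConn S ω u v := by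
  classical
  have step (e : Γ × Fin d) (a b c : Γ) (he : Joins S e a b)
      (hbc : ∀ᵐ ω ∂Measure.infinitePi fun _ ↦ μ,
        (Cluster S ω b).Infinite → (Cluster S ω c).Infinite → OpenConn S ω b c) :
      ∀ᵐ ω ∂Measure.infinitePi fun _ ↦ μ,
        (Cluster S ω a).Infinite → (Cluster S ω c).Infinite → OpenConn S ω a c := by
    have hq := quasiMeasurePreserving_update_infinitePi μ e true hμ
    filter_upwards [h, hq.ae h, hq.ae hbc] with ω h1 h2 h3 ha hc
    refine openConn_of_openConn_update (e := e) (encard_ne_top_iff.1 (h1 ▸ hN)) (h2.trans h1.symm)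
      ha hc ?_
    have hab : OpenConn S (update ω e true) a b := openConn_update_of_joins he
    refine hab.trans (h3 ?_ ?_)
    · rw [← cluster_eq_iff.2 hab]
      exact ha.mono fun x hx ↦ OpenConn.update_true e hx
    · exact hc.mono fun x hx ↦ OpenConn.update_true e hx
  suffices H : ∀ x ∈ Subgroup.closure (Set.range S), ∀ a, ∀ᵐ ω ∂Measure.infinitePi fun _ ↦ μ,
      (Cluster S ω a).Infinite → (Cluster S ω (a * x)).Infinite → OpenConn S ω a (a * x) by
    simpa using H (u⁻¹ * v) (by simp [hgen]) u
  intro x hx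
  induction hx using Subgroup.closure_induction_left with
  | one => exact fun a ↦ .of_forall fun ω _ _ ↦ (mul_one a).symm ▸ .refl
  | mul_left x hx y hy ih =>
    obtain ⟨i, rfl⟩ := hx
    intro a
    rw [← mul_assoc]
    exact step (a, i) a (a * S i) _ (.inl ⟨rfl, rfl⟩) (ih _)
  | inv_mul_cancel x hx y hy ih =>
    obtain ⟨i, rfl⟩ := hx
    intro a
    rw [← mul_assoc]
    exact step (a * (S i)⁻¹, i) a (a * (S i)⁻¹) _ (.inr ⟨rfl, by simp⟩) (ih _)

/-- For Bernoulli(`p`) bond percolation on a Cayley graph of an infinite finitely generated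
group with `0 < p < 1`, the number of infinite clusters is almost surely equal to a constant
`N_p`, and `N_p ∈ {0, 1, ∞}`. -/
theorem number_of_infinite_clusters (Γ : Type) [Group Γ] [Infinite Γ] (d : ℕ)
    (S : Fin d → Γ) (hgen : Subgroup.closure (Set.range S) = ⊤)
    (p : ℝ) (hp : p ∈ Ioo (0:ℝ) 1) :
    ∃ N : ℕ∞, N ∈ ({0, 1, ⊤} : Set ℕ∞) ∧
      ∀ P : Measure (Γ × Fin d → Bool), IsBernoulli S p P →
        P {ω | (InfClusters S ω).encard = N} = 1 := by
  have := isProbabilityMeasure_edgeLaw (Ioo_subset_Icc_self hp)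
  have : Countable Γ := by
    have h : Surjective (FreeGroup.lift S) := by
      rw [← MonoidHom.range_eq_top, FreeGroup.range_lift_eq_closure, hgen]
    exact h.countable
  have hμ : edgeLaw p {true} ≠ 0 := by simpa [edgeLaw_singleton] using hp.1
  obtain ⟨N, hN⟩ := exists_ae_encard_infClusters_eq S (edgeLaw p)
  refine ⟨N, ?_, fun P hP ↦ ?_⟩
  · by_cases htop : N = ⊤
    · simp [htop]
    have hconn := ae_all_iff.2 fun u ↦ ae_all_iff.2 fun v ↦
      ae_openConn_of_ae_encard_eq hgen hμ htop hN u v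
    obtain ⟨ω, rfl, hω⟩ := (hN.and hconn).exists
    have hle : (InfClusters S ω).encard ≤ 1 := by
      rw [encard_le_one_iff]
      rintro _ _ ⟨⟨u, rfl⟩, hu⟩ ⟨⟨v, rfl⟩, hv⟩
      exact cluster_eq_iff.2 (hω u v hu hv)
    rcases eq_or_ne (InfClusters S ω).encard 0 with h | h
    · simp [h]
    · simp [le_antisymm hle (Order.one_le_iff_ne_zero.2 h)]
  · rw [hP.eq_infinitePi]
    exact (mem_ae_iff_prob_eq_one
      (measurable_encard_infClusters S (measurableSet_singleton N))).1 hN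

end
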